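/- arXiv:0902.1935 — 5 statements merged into one kernel-verified Lean document; each statement's English description precedes it below -/
import Mathlib

section
/- (Time-reversal symmetry of transfer matrices.) Let W : ℝ → Mat(2L,ℂ) be continuous with J*·conj(W(x))·J = W(x) for all x, and let z ∈ ℂ. If T : ℝ → Mat(2L,ℂ) is differentiable with J·T'(x) + W(x)·T(x) = z·T(x) and T(0) = 1, then the function x ↦ J*·conj(T(x))·J is differentiable and satisfies J·(J*·conj(T))'(x) + W(x)·(J*·conj(T(x))·J) = conj(z)·(J*·conj(T(x))·J) with value 1 at 0; consequently, if S : ℝ → Mat(2L,ℂ) is the (unique) solution of J·S'(x) + W(x)·S(x) = conj(z)·S(x), S(0) = 1, then S(x) = J*·conj(T(x))·J for all x. -/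
open Matrix

noncomputable section

attribute [local instance] Matrix.normedAddCommGroup Matrix.normedSpace

/-- The `2L × 2L` matrix `J = [[0, -1],[1, 0]]`, with index type `Fin L ⊕ Fin L`. -/
def Jmat (L : ℕ) : Matrix (Fin L ⊕ Fin L) (Fin L ⊕ Fin L) ℂ :=
  Matrix.fromBlocks 0 (-1) 1 0

lemma Jmat_mul_Jmat (L : ℕ) : Jmat L * Jmat L = -1 := by
  simp [Jmat, Matrix.fromBlocks_multiply, ← Matrix.fromBlocks_one, Matrix.fromBlocks_neg]

lemma Jmat_conjTranspose (L : ℕ) : (Jmat L)ᴴ = -Jmat L := by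
  simp [Jmat, Matrix.fromBlocks_conjTranspose, Matrix.fromBlocks_neg]

lemma Jmat_map_conj (L : ℕ) : (Jmat L).map (starRingEnd ℂ) = Jmat L := by
  ext i j
  rcases i with i | i <;> rcases j with j | j <;> simp [Jmat, Matrix.one_apply, apply_ite]

/-- The real-linear map `M ↦ J* conj(M) J`. -/
def timeReversal (L : ℕ) :
    Matrix (Fin L ⊕ Fin L) (Fin L ⊕ Fin L) ℂ →ₗ[ℝ] Matrix (Fin L ⊕ Fin L) (Fin L ⊕ Fin L) ℂ where
  toFun M := (Jmat L)ᴴ * M.map (starRingEnd ℂ) * Jmat L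
  map_add' M N := by
    rw [Matrix.map_add _ (map_add _), mul_add, add_mul]
  map_smul' r M := by
    have h : (r • M).map (starRingEnd ℂ) = r • M.map (starRingEnd ℂ) := by
      ext i j
      simp
    rw [h, Matrix.mul_smul, Matrix.smul_mul, RingHom.id_apply]

lemma timeReversal_apply (L : ℕ) (M : Matrix (Fin L ⊕ Fin L) (Fin L ⊕ Fin L) ℂ) :
    timeReversal L M = (Jmat L)ᴴ * M.map (starRingEnd ℂ) * Jmat L := rfl

lemma timeReversal_mul (L : ℕ) (M N : Matrix (Fin L ⊕ Fin L) (Fin L ⊕ Fin L) ℂ) :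
    timeReversal L (M * N) = timeReversal L M * timeReversal L N := by
  have h (A : Matrix (Fin L ⊕ Fin L) (Fin L ⊕ Fin L) ℂ) : Jmat L * (Jmat L * A) = -A := by
    rw [← mul_assoc, Jmat_mul_Jmat, neg_one_mul]
  simp [timeReversal_apply, Jmat_conjTranspose, Matrix.map_mul, mul_assoc, h]

lemma timeReversal_smul (L : ℕ) (z : ℂ) (M : Matrix (Fin L ⊕ Fin L) (Fin L ⊕ Fin L) ℂ) :
    timeReversal L (z • M) = starRingEnd ℂ z • timeReversal L M := by
  have h : (z • M).map (starRingEnd ℂ) = starRingEnd ℂ z • M.map (starRingEnd ℂ) := by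
    ext i j
    simp
  rw [timeReversal_apply, h, Matrix.mul_smul, Matrix.smul_mul, timeReversal_apply]

lemma timeReversal_Jmat (L : ℕ) : timeReversal L (Jmat L) = Jmat L := by
  simp [timeReversal_apply, Jmat_conjTranspose, Jmat_map_conj, Jmat_mul_Jmat]

lemma timeReversal_one (L : ℕ) : timeReversal L 1 = 1 := by
  simp [timeReversal_apply, Jmat_conjTranspose, Jmat_mul_Jmat]

/-- Solutions of a linear ODE with continuous coefficients are determined by one value. -/
lemma eq_of_hasDerivAt_clm_apply {E : Type*} [NormedAddCommGroup E] [NormedSpace ℝ E]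
    {A : ℝ → E →L[ℝ] E} (hA : Continuous A) {f g : ℝ → E} {t₀ : ℝ}
    (hf : ∀ t, HasDerivAt f (A t (f t)) t) (hg : ∀ t, HasDerivAt g (A t (g t)) t)
    (h₀ : f t₀ = g t₀) : f = g := by
  funext x
  obtain ⟨R, hxR, htR⟩ : ∃ R : ℝ, |x| < R ∧ |t₀| < R :=
    ⟨max |x| |t₀| + 1, by linarith [le_max_left |x| |t₀|], by linarith [le_max_right |x| |t₀|]⟩
  obtain ⟨C, hC⟩ := (isCompact_Icc (a := -R) (b := R)).exists_bound_of_continuousOn hA.continuousOn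
  have hlip : ∀ t ∈ Set.Ioo (-R) R, LipschitzOnWith C.toNNReal (fun y => A t y) Set.univ := by
    intro t ht
    refine ((A t).lipschitz.weaken ?_).lipschitzOnWith
    rw [← norm_toNNReal]
    exact Real.toNNReal_le_toNNReal (hC t (Set.Ioo_subset_Icc_self ht))
  exact ODE_solution_unique_of_mem_Ioo hlip (abs_lt.mp htR)
    (fun t _ => ⟨hf t, Set.mem_univ _⟩) (fun t _ => ⟨hg t, Set.mem_univ _⟩) h₀ (abs_lt.mp hxR)

/-- Solutions of `J S' + W S = z S` with continuous `W` are determined by their value at `0`. -/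
lemma eq_of_transfer_equation {L : ℕ} {W : ℝ → Matrix (Fin L ⊕ Fin L) (Fin L ⊕ Fin L) ℂ}
    (hW : Continuous W) {z : ℂ} {S S' R R' : ℝ → Matrix (Fin L ⊕ Fin L) (Fin L ⊕ Fin L) ℂ}
    (hS : ∀ x, HasDerivAt S (S' x) x) (hSeq : ∀ x, Jmat L * S' x + W x * S x = z • S x)
    (hR : ∀ x, HasDerivAt R (R' x) x) (hReq : ∀ x, Jmat L * R' x + W x * R x = z • R x)
    (h₀ : S 0 = R 0) : S = R := by
  let mulLeftCLM : Matrix (Fin L ⊕ Fin L) (Fin L ⊕ Fin L) ℂ →ₗ[ℝ]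
      Matrix (Fin L ⊕ Fin L) (Fin L ⊕ Fin L) ℂ →L[ℝ] Matrix (Fin L ⊕ Fin L) (Fin L ⊕ Fin L) ℂ :=
    LinearMap.toContinuousLinearMap.toLinearMap ∘ₗ LinearMap.mul ℝ _
  have hcont : Continuous fun x => mulLeftCLM (Jmat L * (W x - z • 1)) :=
    mulLeftCLM.continuous_of_finiteDimensional.comp
      (continuous_const.matrix_mul (hW.sub continuous_const))
  have key (x : ℝ) (M D : Matrix (Fin L ⊕ Fin L) (Fin L ⊕ Fin L) ℂ)
      (h : Jmat L * D + W x * M = z • M) : D = mulLeftCLM (Jmat L * (W x - z • 1)) M := by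
    change D = Jmat L * (W x - z • 1) * M
    have hD : Jmat L * D = -((W x - z • 1) * M) := by
      rw [sub_mul, Matrix.smul_mul, one_mul, ← h]
      abel
    have hJ := congrArg (Jmat L * ·) hD
    simp only [← mul_assoc, Jmat_mul_Jmat, mul_neg, neg_one_mul] at hJ
    exact neg_injective hJ
  exact eq_of_hasDerivAt_clm_apply hcont
    (fun t => (hS t).congr_deriv (key t _ _ (hSeq t)))
    (fun t => (hR t).congr_deriv (key t _ _ (hReq t))) h₀

/-- time-reversal symmetry of transfer matrices.  If `T` solves
`J T' + W T = z T`, `T 0 = 1`, then `x ↦ J* conj(T x) J` solves the same equation with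
`z` replaced by `conj z`, and any solution `S` of the latter equation equals it. -/
theorem time_reversal_transfer_matrices (L : ℕ) (hL : 0 < L)
    (W : ℝ → Matrix (Fin L ⊕ Fin L) (Fin L ⊕ Fin L) ℂ)
    (hWcont : Continuous W)
    (hWsym : ∀ x, (Jmat L)ᴴ * (W x).map (starRingEnd ℂ) * Jmat L = W x)
    (z : ℂ)
    (T T' : ℝ → Matrix (Fin L ⊕ Fin L) (Fin L ⊕ Fin L) ℂ)
    (hT : ∀ x, HasDerivAt T (T' x) x)
    (hTeq : ∀ x, Jmat L * T' x + W x * T x = z • T x)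
    (hT0 : T 0 = 1) :
    (∀ x, ∃ D, HasDerivAt (fun y => (Jmat L)ᴴ * (T y).map (starRingEnd ℂ) * Jmat L) D x ∧
      Jmat L * D + W x * ((Jmat L)ᴴ * (T x).map (starRingEnd ℂ) * Jmat L) =
        (starRingEnd ℂ z) • ((Jmat L)ᴴ * (T x).map (starRingEnd ℂ) * Jmat L)) ∧
    ((Jmat L)ᴴ * (T 0).map (starRingEnd ℂ) * Jmat L = 1) ∧
    (∀ S S' : ℝ → Matrix (Fin L ⊕ Fin L) (Fin L ⊕ Fin L) ℂ,
      (∀ x, HasDerivAt S (S' x) x) →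
      (∀ x, Jmat L * S' x + W x * S x = (starRingEnd ℂ z) • S x) →
      S 0 = 1 →
      ∀ x, S x = (Jmat L)ᴴ * (T x).map (starRingEnd ℂ) * Jmat L) := by
  have hderiv (x : ℝ) : HasDerivAt (fun y => timeReversal L (T y)) (timeReversal L (T' x)) x :=
    (timeReversal L).toContinuousLinearMap.hasFDerivAt.comp_hasDerivAt x (hT x)
  have heq (x : ℝ) : Jmat L * timeReversal L (T' x) + W x * timeReversal L (T x) =
      starRingEnd ℂ z • timeReversal L (T x) := by
    have h := congrArg (timeReversal L) (hTeq x)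
    rwa [map_add, timeReversal_mul, timeReversal_mul, timeReversal_smul, timeReversal_Jmat,
      timeReversal_apply L (W x), hWsym] at h
  have hzero : timeReversal L (T 0) = 1 := by rw [hT0, timeReversal_one]
  exact ⟨fun x => ⟨_, hderiv x, heq x⟩, hzero, fun S S' hS hSeq hS0 x =>
    congrFun (eq_of_transfer_equation hWcont hS hSeq hderiv heq (hS0.trans hzero.symm)) x⟩
end
end

section
/- Let T ∈ Mat(2L,ℂ) satisfy T*·J·T = J. Let Φ₊ = (α₊; β₊) and Φ₋ = (α₋; β₋) be 2L×L complex matrices (written in two L×L blocks) with β₊ and β₋ invertible, such that Im(α₊·β₊⁻¹) is positive definite and Im(α₋·β₋⁻¹) is negative definite. Then the only vectors u, w ∈ ℂ^L with T·Φ₊·u = Φ₋·w are u = w = 0 (in particular, taking T = 1, the column spans of Φ₊ and Φ₋ intersect trivially), and the 2L×2L matrix T·Φ₊·Φ₋* − Φ₋·Φ₊* is invertible. -/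
open Matrix
open scoped ComplexOrder

noncomputable section

/-- Imaginary part `Im(Z) = (i/2)(Z* - Z)` of a square complex matrix. -/
def matIm {n : Type*} (Z : Matrix n n ℂ) : Matrix n n ℂ :=
  (Complex.I / 2) • (Zᴴ - Z)

theorem Matrix.isUnit_fromCols_of_ranges_disjoint {𝕜 m n : Type*} [Field 𝕜] [Fintype m] [Fintype n]
    [DecidableEq m] [DecidableEq n] {A : Matrix (m ⊕ n) m 𝕜} {B : Matrix (m ⊕ n) n 𝕜}
    (h : ∀ u w, A *ᵥ u = B *ᵥ w → u = 0 ∧ w = 0) : IsUnit (fromCols A B) := by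
  rw [← mulVec_injective_iff_isUnit]
  refine (injective_iff_map_eq_zero (fromCols A B).mulVecLin).2 fun v hv => ?_
  rw [mulVecLin_apply, fromCols_mulVec] at hv
  obtain ⟨hu, hw⟩ := h (v ∘ Sum.inl) (-(v ∘ Sum.inr)) <| by
    rw [mulVec_neg]; exact eq_neg_of_add_eq_zero_left hv
  ext (i | i)
  · exact congrFun hu i
  · exact congrFun (neg_eq_zero.1 hw) i

theorem conjTranspose_mul_Jmat_mul_fromRows {L : ℕ} (α : Matrix (Fin L) (Fin L) ℂ)
    {β : Matrix (Fin L) (Fin L) ℂ} (hβ : IsUnit β) :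
    (fromRows α β)ᴴ * Jmat L * fromRows α β =
      (2 * Complex.I) • (βᴴ * matIm (α * β⁻¹) * β) := by
  have hdet : IsUnit β.det := (isUnit_iff_isUnit_det β).1 hβ
  have hα : α * β⁻¹ * β = α := nonsing_inv_mul_cancel_right β α hdet
  have hα' : βᴴ * (α * β⁻¹)ᴴ = αᴴ := by rw [← conjTranspose_mul, hα]
  have hI : 2 * Complex.I * (Complex.I / 2) = -1 := by
    linear_combination Complex.I_mul_I
  rw [matIm, Matrix.mul_smul, Matrix.smul_mul, smul_smul, hI, Matrix.mul_sub, Matrix.sub_mul, hα',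
    Matrix.mul_assoc βᴴ, hα, conjTranspose_fromRows_eq_fromCols_conjTranspose, Jmat,
    fromCols_mul_fromBlocks, fromCols_mul_fromRows]
  simp
  abel

/-- A `J`-unitary matrix cannot map a nonzero vector of a `J`-positive plane to a `J`-negative
one. -/
theorem eq_zero_of_mulVec_fromRows_eq {L : ℕ} {T : Matrix (Fin L ⊕ Fin L) (Fin L ⊕ Fin L) ℂ}
    (hT : Tᴴ * Jmat L * T = Jmat L) {αp βp αm βm : Matrix (Fin L) (Fin L) ℂ}
    (hβp : IsUnit βp) (hβm : IsUnit βm) (hp : (matIm (αp * βp⁻¹)).PosDef)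
    (hm : (-(matIm (αm * βm⁻¹))).PosDef) {u w : Fin L → ℂ}
    (h : (T * fromRows αp βp) *ᵥ u = fromRows αm βm *ᵥ w) : u = 0 ∧ w = 0 := by
  have hP := hp.conjTranspose_mul_mul_same (mulVec_injective_of_isUnit hβp)
  have hN := hm.conjTranspose_mul_mul_same (mulVec_injective_of_isUnit hβm)
  have form (A : Matrix (Fin L ⊕ Fin L) (Fin L) ℂ) (v : Fin L → ℂ) :
      star (A *ᵥ v) ⬝ᵥ (Jmat L *ᵥ (A *ᵥ v)) = star v ⬝ᵥ ((Aᴴ * Jmat L * A) *ᵥ v) := by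
    simp only [star_mulVec, dotProduct_mulVec, vecMul_vecMul, Matrix.mul_assoc]
  have hTp : (T * fromRows αp βp)ᴴ * Jmat L * (T * fromRows αp βp) =
      (fromRows αp βp)ᴴ * Jmat L * fromRows αp βp := by
    rw [conjTranspose_mul]
    nth_rewrite 2 [← hT]
    simp only [Matrix.mul_assoc]
  have key := form (T * fromRows αp βp) u
  rw [h, form, hTp, conjTranspose_mul_Jmat_mul_fromRows αp hβp,
    conjTranspose_mul_Jmat_mul_fromRows αm hβm, smul_mulVec, smul_mulVec, dotProduct_smul,
    dotProduct_smul] at key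
  have key' := smul_right_injective ℂ (mul_ne_zero two_ne_zero Complex.I_ne_zero) key
  have hsum : star u ⬝ᵥ ((βpᴴ * matIm (αp * βp⁻¹) * βp) *ᵥ u) +
      star w ⬝ᵥ ((βmᴴ * -matIm (αm * βm⁻¹) * βm) *ᵥ w) = 0 := by
    rw [Matrix.mul_neg, Matrix.neg_mul, neg_mulVec, dotProduct_neg, key', add_neg_cancel]
  have hu0 := hP.posSemidef.dotProduct_mulVec_nonneg u
  have hw0 := hN.posSemidef.dotProduct_mulVec_nonneg w
  constructor
  · by_contra hu
    exact (add_pos_of_pos_of_nonneg (hP.dotProduct_mulVec_pos hu) hw0).ne' hsum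
  · by_contra hw
    exact (add_pos_of_nonneg_of_pos hu0 (hN.dotProduct_mulVec_pos hw)).ne' hsum

/-- trivial intersection of the ranges of `T·Φ₊` and `Φ₋`, and invertibility of
`T·Φ₊·Φ₋* − Φ₋·Φ₊*`. -/
theorem transversality_of_weyl_planes (L : ℕ) (hL : 0 < L)
    (T : Matrix (Fin L ⊕ Fin L) (Fin L ⊕ Fin L) ℂ)
    (hT : Tᴴ * Jmat L * T = Jmat L)
    (αp βp αm βm : Matrix (Fin L) (Fin L) ℂ)
    (hβp : IsUnit βp) (hβm : IsUnit βm)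
    (hp : (matIm (αp * βp⁻¹)).PosDef)
    (hm : (-(matIm (αm * βm⁻¹))).PosDef) :
    (∀ u w : Fin L → ℂ,
      (T * Matrix.fromRows αp βp).mulVec u = (Matrix.fromRows αm βm).mulVec w →
      u = 0 ∧ w = 0) ∧
    IsUnit (T * Matrix.fromRows αp βp * (Matrix.fromRows αm βm)ᴴ -
      Matrix.fromRows αm βm * (Matrix.fromRows αp βp)ᴴ) := by
  have hker : ∀ u w : Fin L → ℂ,
      (T * fromRows αp βp) *ᵥ u = fromRows αm βm *ᵥ w → u = 0 ∧ w = 0 :=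
    fun _ _ h => eq_zero_of_mulVec_fromRows_eq hT hβp hβm hp hm h
  refine ⟨hker, ?_⟩
  have hleft : IsUnit (fromCols (T * fromRows αp βp) (fromRows αm βm)) :=
    isUnit_fromCols_of_ranges_disjoint hker
  have hright : IsUnit (fromCols (fromRows αm βm) (-fromRows αp βp)) := by
    refine isUnit_fromCols_of_ranges_disjoint fun u w h => ?_
    have := eq_zero_of_mulVec_fromRows_eq (T := 1) (u := -w) (w := u) (by simp) hβp hβm hp hm <| by
      rw [Matrix.one_mul, h, mulVec_neg, neg_mulVec]
    exact ⟨this.2, neg_eq_zero.1 this.1⟩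
  have hfactor : T * fromRows αp βp * (fromRows αm βm)ᴴ - fromRows αm βm * (fromRows αp βp)ᴴ =
      fromCols (T * fromRows αp βp) (fromRows αm βm) *
        (fromCols (fromRows αm βm) (-fromRows αp βp))ᴴ := by
    rw [conjTranspose_fromCols_eq_fromRows_conjTranspose, fromCols_mul_fromRows,
      conjTranspose_neg, Matrix.mul_neg, sub_eq_add_neg]
  rw [hfactor]
  exact hleft.mul hright.star
end
end

section
/- (Derivative identity for the sum of Weyl–Titchmarsh matrices.) Let I ⊆ ℝ be an interval, z ∈ ℂ, and let P, Q, R : I → Mat(L,ℂ) and M₊, M₋ : I → Mat(L,ℂ) be functions with M₊, M₋ differentiable. Suppose the Riccati equations M₊'(x) = (P(x) − z·1) + M₊(x)·R(x)* + R(x)·M₊(x) + M₊(x)·(Q(x) − z·1)·M₊(x) and −M₋'(x) = (P(x) − z·1) − M₋(x)·R(x)* − R(x)·M₋(x) + M₋(x)·(Q(x) − z·1)·M₋(x) hold on I. Then for all x ∈ I: (M₊ + M₋)'(x) = (M₊(x) + M₋(x))·(R(x)* − (Q(x) − z·1)·M₋(x)) + (R(x) + M₊(x)·(Q(x) − z·1))·(M₊(x)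 + M₋(x)). -/
open Matrix

noncomputable section

attribute [local instance] Matrix.normedAddCommGroup Matrix.normedSpace

/-- derivative identity for the sum of the Weyl–Titchmarsh matrices.
Here `Mp` plays the role of `M₊` and `Mm` that of `M₋`. -/
theorem deriv_sum_weyl_titchmarsh (L : ℕ) (hL : 0 < L)
    (I : Set ℝ) (hI : I.OrdConnected) (z : ℂ)
    (P Q R Mp Mm Mp' Mm' : ℝ → Matrix (Fin L) (Fin L) ℂ)
    (hMp : ∀ x ∈ I, HasDerivAt Mp (Mp' x) x)
    (hMm : ∀ x ∈ I, HasDerivAt Mm (Mm' x) x)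
    (hRicp : ∀ x ∈ I, Mp' x =
      (P x - z • 1) + Mp x * (R x)ᴴ + R x * Mp x + Mp x * (Q x - z • 1) * Mp x)
    (hRicm : ∀ x ∈ I, -Mm' x =
      (P x - z • 1) - Mm x * (R x)ᴴ - R x * Mm x + Mm x * (Q x - z • 1) * Mm x) :
    ∀ x ∈ I, HasDerivAt (fun y => Mp y + Mm y)
      ((Mp x + Mm x) * ((R x)ᴴ - (Q x - z • 1) * Mm x) +
        (R x + Mp x * (Q x - z • 1)) * (Mp x + Mm x)) x := by
  intro x hx
  have hsum : (Mp x + Mm x) * ((R x)ᴴ - (Q x - z • 1) * Mm x) +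
      (R x + Mp x * (Q x - z • 1)) * (Mp x + Mm x) = Mp' x + Mm' x := by
    rw [← neg_neg (Mm' x), hRicm x hx, hRicp x hx]
    generalize Q x - z • 1 = A
    generalize P x - z • 1 = B
    noncomm_ring
  rw [hsum]
  exact (hMp x hx).add (hMm x hx)
end
end

section
/- (Monotonicity identity for the Weyl–Titchmarsh flow.) Let I ⊆ ℝ be an interval, z ∈ ℂ, s ∈ {+1, −1}, and let P, Q, R : I → Mat(L,ℂ) with P(x) and Q(x) hermitian for all x. Let M, α : I → Mat(L,ℂ) be differentiable and suppose s·M'(x) = (P(x) − z·1) + s·(M(x)·R(x)* + R(x)·M(x)) + M(x)·(Q(x) − z·1)·M(x) and α'(x) = (−R(x)* − s·(Q(x) − z·1)·M(x))·α(x) on I. Then for all x ∈ I: d/dx [ α(x)*·Im(M(x))·α(x) ] = −s·Im(z)·α(x)*·(1 + M(x)*·M(x))·α(x). -/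
open Matrix

noncomputable section

attribute [local instance] Matrix.normedAddCommGroup Matrix.normedSpace

/-- A curve of matrices is differentiable iff it is so entrywise. -/
theorem hasDerivAt_matrix_iff {m n : Type*} [Fintype m] [Fintype n]
    {A : ℝ → Matrix m n ℂ} {A' : Matrix m n ℂ} {x : ℝ} :
    HasDerivAt A A' x ↔ ∀ i j, HasDerivAt (fun y => A y i j) (A' i j) x := by
  refine Iff.trans (hasDerivAt_pi (φ := fun y i => A y i) (φ' := fun i => A' i)) ?_
  exact forall_congr' fun i => hasDerivAt_pi

/-- Product rule for curves of matrices. -/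
theorem HasDerivAt.matrix_mul {l m n : Type*} [Fintype l] [Fintype m] [Fintype n]
    {A : ℝ → Matrix l m ℂ} {B : ℝ → Matrix m n ℂ} {A' : Matrix l m ℂ} {B' : Matrix m n ℂ}
    {x : ℝ} (hA : HasDerivAt A A' x) (hB : HasDerivAt B B' x) :
    HasDerivAt (fun y => A y * B y) (A' * B x + A x * B') x := by
  rw [hasDerivAt_matrix_iff] at hA hB ⊢
  intro i j
  simp only [Matrix.add_apply, Matrix.mul_apply, ← Finset.sum_add_distrib]
  exact HasDerivAt.fun_sum fun k _ => (hA i k).fun_mul (hB k j)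

theorem HasDerivAt.matrix_conjTranspose {m n : Type*} [Fintype m] [Fintype n]
    {A : ℝ → Matrix m n ℂ} {A' : Matrix m n ℂ} {x : ℝ} (hA : HasDerivAt A A' x) :
    HasDerivAt (fun y => (A y)ᴴ) A'ᴴ x := by
  rw [hasDerivAt_matrix_iff] at hA ⊢
  exact fun i j => (hA j i).star

theorem HasDerivAt.matIm {n : Type*} [Fintype n]
    {A : ℝ → Matrix n n ℂ} {A' : Matrix n n ℂ} {x : ℝ} (hA : HasDerivAt A A' x) :
    HasDerivAt (fun y => _root_.matIm (A y)) (_root_.matIm A') x := by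
  have hD := hasDerivAt_matrix_iff.1 (hA.matrix_conjTranspose.fun_sub hA)
  exact hasDerivAt_matrix_iff.2 fun i j => (hD i j).const_mul (Complex.I / 2)

/-- The infinitesimal form of the monotonicity identity, before conjugation by the
cocycle. -/
theorem matIm_riccati_identity {n : Type*} [Fintype n] [DecidableEq n] {z : ℂ} {s : ℝ}
    (hs : s = 1 ∨ s = -1) {P Q R M M' : Matrix n n ℂ} (hP : Pᴴ = P) (hQ : Qᴴ = Q)
    (hRic : (s : ℂ) • M' = (P - z • 1) + (s : ℂ) • (M * Rᴴ + R * M) + M * (Q - z • 1) * M) :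
    (-Rᴴ - (s : ℂ) • ((Q - z • 1) * M))ᴴ * matIm M + matIm M'
        + matIm M * (-Rᴴ - (s : ℂ) • ((Q - z • 1) * M)) =
      (-(s * z.im : ℝ) : ℂ) • (1 + Mᴴ * M) := by
  have hss : (s : ℂ) * s = 1 := by rcases hs with rfl | rfl <;> simp
  have hM' : M' = (s : ℂ) • (P - z • 1) + (M * Rᴴ + R * M)
      + (s : ℂ) • (M * (Q - z • 1) * M) := by
    rw [← one_smul ℂ M', ← hss, mul_smul, hRic, smul_add, smul_add, smul_smul, hss, one_smul]
  have hz : (-(s * z.im : ℝ) : ℂ) = (Complex.I / 2) * (s * (z - star z)) := by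
    have h : z - star z = 2 * z.im * Complex.I := by
      simpa using Complex.sub_conj z
    rw [h]
    push_cast
    linear_combination (-(s : ℂ) * z.im) * Complex.I_mul_I
  rw [hz, hM', mul_smul]
  simp only [matIm, Matrix.mul_smul, Matrix.smul_mul, ← smul_add]
  congr 1
  simp only [conjTranspose_add, conjTranspose_sub, conjTranspose_neg, conjTranspose_smul,
    conjTranspose_mul, conjTranspose_conjTranspose, conjTranspose_one, hP, hQ,
    Complex.star_def, Complex.conj_ofReal, Matrix.mul_sub, Matrix.sub_mul,
    Matrix.mul_smul, Matrix.smul_mul, Matrix.mul_one, Matrix.one_mul,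
    Matrix.neg_mul, Matrix.mul_neg, Matrix.mul_assoc]
  module

/-- monotonicity identity for the Weyl–Titchmarsh flow:
`d/dx [α* Im(M) α] = -s·Im(z)·α*(1 + M* M)α`. -/
theorem deriv_weyl_titchmarsh_monotonicity (L : ℕ) (hL : 0 < L)
    (I : Set ℝ) (hI : I.OrdConnected) (z : ℂ) (s : ℝ) (hs : s = 1 ∨ s = -1)
    (P Q R M M' α α' : ℝ → Matrix (Fin L) (Fin L) ℂ)
    (hP : ∀ x, (P x)ᴴ = P x) (hQ : ∀ x, (Q x)ᴴ = Q x)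
    (hM : ∀ x ∈ I, HasDerivAt M (M' x) x)
    (hRic : ∀ x ∈ I, (s : ℂ) • M' x =
      (P x - z • 1) + (s : ℂ) • (M x * (R x)ᴴ + R x * M x) + M x * (Q x - z • 1) * M x)
    (hα : ∀ x ∈ I, HasDerivAt α (α' x) x)
    (hαeq : ∀ x ∈ I, α' x = (-(R x)ᴴ - (s : ℂ) • ((Q x - z • 1) * M x)) * α x) :
    ∀ x ∈ I, HasDerivAt (fun y => (α y)ᴴ * matIm (M y) * α y)
      ((-(s * z.im : ℝ) : ℂ) • ((α x)ᴴ * (1 + (M x)ᴴ * M x) * α x)) x := by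
  intro x hx
  have h := ((hα x hx).matrix_conjTranspose.matrix_mul (hM x hx).matIm).matrix_mul (hα x hx)
  convert h using 1
  rw [hαeq x hx, ← Matrix.smul_mul, ← Matrix.mul_smul,
    ← matIm_riccati_identity hs (hP x) (hQ x) (hRic x hx)]
  simp only [conjTranspose_mul, Matrix.mul_add, Matrix.add_mul, Matrix.mul_assoc]
end
end

section
/- (Rank-two perturbation formula with Kramers structure.) Let G ∈ Mat(2L,ℂ) be invertible with J*·G·J = Gᵗ, let 1 ≤ k ≤ L, let λ ∈ ℂ, and let Ψ_m denote the 2L×2 matrix with columns e_m and e_{L+m}. Suppose G⁻¹ + λ·Ψ_k·Ψ_k* is invertible and set G_λ := (G⁻¹ + λ·Ψ_k·Ψ_k*)⁻¹. Then: (a) e_k*·G·e_{L+k} = 0 = e_{L+k}*·G·e_k and e_{L+k}*·G·e_{L+k} = e_k*·G·e_k, so Ψ_k*·G·Ψ_k = (e_k*·G·e_k)·1₂; (b) 1 + λ·(e_k*·G·e_k) ≠ 0; (c) Ψ_k*·G_λ = (1 + λ·e_k*·G·e_k)⁻¹·Ψ_k*·G, and in particular Ψ_k*·G_λ·Ψ_l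 = (1 + λ·e_k*·G·e_k)⁻¹·Ψ_k*·G·Ψ_l for every 1 ≤ l ≤ L and e_k*·G_λ·e_k = (1 + λ·e_k*·G·e_k)⁻¹·(e_k*·G·e_k). -/
open Matrix

noncomputable section

/-- The `2L × 2` matrix `Ψ_k` whose columns are the standard basis vectors
`e_k` and `e_{L+k}` of `ℂ^{2L}`. -/
def Psi (L : ℕ) (k : Fin L) : Matrix (Fin L ⊕ Fin L) (Fin 2) ℂ :=
  Matrix.of fun i t =>
    if t = 0 then (if i = Sum.inl k then 1 else 0)
    else (if i = Sum.inr k then 1 else 0)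

/-- The `2 × 2` symplectic form `j = [[0, -1],[1, 0]]`. -/
def j2 : Matrix (Fin 2) (Fin 2) ℂ := !![0, -1; 1, 0]

/-- A matrix `W` is self-dual if `W* = W` and `J* conj(W) J = W`. -/
def IsSelfDual (L : ℕ) (W : Matrix (Fin L ⊕ Fin L) (Fin L ⊕ Fin L) ℂ) : Prop :=
  Wᴴ = W ∧ (Jmat L)ᴴ * (W.map (starRingEnd ℂ)) * Jmat L = W

/-- A matrix with `J* G J = Gᵗ` has off-diagonal Kramers entries equal to zero and equal diagonal
Kramers entries. -/
lemma kramers_entries {L : ℕ} {G : Matrix (Fin L ⊕ Fin L) (Fin L ⊕ Fin L) ℂ}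
    (hG : (Jmat L)ᴴ * G * Jmat L = Gᵀ) (k : Fin L) :
    G (Sum.inl k) (Sum.inr k) = 0 ∧ G (Sum.inr k) (Sum.inl k) = 0 ∧
      G (Sum.inr k) (Sum.inr k) = G (Sum.inl k) (Sum.inl k) := by
  rw [← Matrix.fromBlocks_toBlocks G] at hG
  simp only [Jmat, fromBlocks_conjTranspose, fromBlocks_multiply, fromBlocks_transpose,
    fromBlocks_inj] at hG
  obtain ⟨h11, h12, h21, -⟩ := hG
  have e11 := congrFun₂ h11 k k
  have e12 := congrFun₂ h12 k k
  have e21 := congrFun₂ h21 k k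
  simp [toBlocks₁₁, toBlocks₁₂, toBlocks₂₁, toBlocks₂₂] at e11 e12 e21
  exact ⟨self_eq_neg.mp e21.symm, self_eq_neg.mp e12.symm, e11⟩

/-- Compressing by `Ψ_k` and `Ψ_l` extracts a `2 × 2` block of entries. -/
lemma Psi_conjTranspose_mul_mul_Psi {L : ℕ}
    (M : Matrix (Fin L ⊕ Fin L) (Fin L ⊕ Fin L) ℂ) (k l : Fin L) :
    (Psi L k)ᴴ * M * Psi L l =
      !![M (Sum.inl k) (Sum.inl l), M (Sum.inl k) (Sum.inr l);
         M (Sum.inr k) (Sum.inl l), M (Sum.inr k) (Sum.inr l)] := by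
  ext s t
  fin_cases s <;> fin_cases t <;>
    simp [Psi, Matrix.mul_apply, Matrix.conjTranspose_apply, apply_ite (starRingEnd ℂ)]

/-- If the compression `Q G P` is the scalar `g`, then `Q G (G⁻¹ + c P Q) = (1 + c g) Q`. -/
lemma mul_mul_inv_add_smul_of_compression_eq_smul {n m R : Type*} [Fintype n] [DecidableEq n]
    [Fintype m] [DecidableEq m] [CommRing R] {G : Matrix n n R} (hG : IsUnit G)
    {P : Matrix n m R} {Q : Matrix m n R} {g : R} (c : R)
    (h : Q * G * P = g • (1 : Matrix m m R)) :
    Q * G * (G⁻¹ + c • (P * Q)) = (1 + c * g) • Q := by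
  rw [Matrix.mul_add, Matrix.mul_nonsing_inv_cancel_right _ _ ((isUnit_iff_isUnit_det G).mp hG),
    Matrix.mul_smul, ← Matrix.mul_assoc, h, Matrix.smul_mul, Matrix.one_mul, smul_smul, add_smul,
    one_smul]

/-- rank-two perturbation formula with Kramers structure. -/
theorem rank_two_perturbation_kramers (L : ℕ) (hL : 0 < L)
    (G : Matrix (Fin L ⊕ Fin L) (Fin L ⊕ Fin L) ℂ)
    (hGunit : IsUnit G)
    (hGsym : (Jmat L)ᴴ * G * Jmat L = Gᵀ)
    (k : Fin L) (lam : ℂ)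
    (hinv : IsUnit (G⁻¹ + lam • (Psi L k * (Psi L k)ᴴ))) :
    -- (a)
    (G (Sum.inl k) (Sum.inr k) = 0 ∧ G (Sum.inr k) (Sum.inl k) = 0 ∧
      G (Sum.inr k) (Sum.inr k) = G (Sum.inl k) (Sum.inl k) ∧
      (Psi L k)ᴴ * G * Psi L k = G (Sum.inl k) (Sum.inl k) • (1 : Matrix (Fin 2) (Fin 2) ℂ)) ∧
    -- (b)
    1 + lam * G (Sum.inl k) (Sum.inl k) ≠ 0 ∧
    -- (c)
    ((Psi L k)ᴴ * (G⁻¹ + lam • (Psi L k * (Psi L k)ᴴ))⁻¹ =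
        (1 + lam * G (Sum.inl k) (Sum.inl k))⁻¹ • ((Psi L k)ᴴ * G) ∧
      (∀ l : Fin L, (Psi L k)ᴴ * (G⁻¹ + lam • (Psi L k * (Psi L k)ᴴ))⁻¹ * Psi L l =
        (1 + lam * G (Sum.inl k) (Sum.inl k))⁻¹ • ((Psi L k)ᴴ * G * Psi L l)) ∧
      (G⁻¹ + lam • (Psi L k * (Psi L k)ᴴ))⁻¹ (Sum.inl k) (Sum.inl k) =
        (1 + lam * G (Sum.inl k) (Sum.inl k))⁻¹ * G (Sum.inl k) (Sum.inl k)) := by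
  obtain ⟨h12, h21, h22⟩ := kramers_entries hGsym k
  have hcomp : (Psi L k)ᴴ * G * Psi L k =
      G (Sum.inl k) (Sum.inl k) • (1 : Matrix (Fin 2) (Fin 2) ℂ) := by
    rw [Psi_conjTranspose_mul_mul_Psi, h12, h21, h22, Matrix.one_fin_two]
    simp
  have key := mul_mul_inv_add_smul_of_compression_eq_smul hGunit lam hcomp
  have hdet := (isUnit_iff_isUnit_det _).mp hinv
  have hne : 1 + lam * G (Sum.inl k) (Sum.inl k) ≠ 0 := by
    intro h0
    rw [h0, zero_smul] at key
    have hQG : (Psi L k)ᴴ * G = 0 := by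
      rw [← Matrix.mul_nonsing_inv_cancel_right _ ((Psi L k)ᴴ * G) hdet, key, Matrix.zero_mul]
    have hQ : (Psi L k)ᴴ = 0 := by
      rw [← Matrix.mul_nonsing_inv_cancel_right _ (Psi L k)ᴴ
        ((isUnit_iff_isUnit_det G).mp hGunit), hQG, Matrix.zero_mul]
    simpa [Psi] using congrFun₂ hQ 0 (Sum.inl k)
  have hrow : (Psi L k)ᴴ * (G⁻¹ + lam • (Psi L k * (Psi L k)ᴴ))⁻¹ =
      (1 + lam * G (Sum.inl k) (Sum.inl k))⁻¹ • ((Psi L k)ᴴ * G) := by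
    rw [← Matrix.mul_nonsing_inv_cancel_right _ ((Psi L k)ᴴ * G) hdet, key, Matrix.smul_mul,
      smul_smul, inv_mul_cancel₀ hne, one_smul]
  have hblock (l : Fin L) : (Psi L k)ᴴ * (G⁻¹ + lam • (Psi L k * (Psi L k)ᴴ))⁻¹ * Psi L l =
      (1 + lam * G (Sum.inl k) (Sum.inl k))⁻¹ • ((Psi L k)ᴴ * G * Psi L l) := by
    rw [hrow, Matrix.smul_mul]
  refine ⟨⟨h12, h21, h22, hcomp⟩, hne, hrow, hblock, ?_⟩
  have hk := hblock k
  rw [Psi_conjTranspose_mul_mul_Psi, Psi_conjTranspose_mul_mul_Psi] at hk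
  simpa using congrFun₂ hk 0 0
end
end
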